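/- Let k be an algebraically closed field. There exist a positive integer n, homogeneous polynomials x, y, u, v of degree 1 and homogeneous polynomials f, g, p, q of degree 2 in the polynomial ring k[x_1,…,x_n], such that the degree-4 form x²f + y²g + u²p + v²q has strength exactly 4, i.e., it admits a strength decomposition of length 4 but admits no strength decomposition of length 3. -/

import Mathlib

/-- `F` admits a strength decomposition of length `r` in the standard-graded polynomial
ring `k[x_1,…,x_n]`: an expression `F = ∑ i, g i * h i` where each `g i`, `h i` is
homogeneous of some degree between `1` and `d - 1` (here `d` is the degree of `F`). -/
def HasStrengthDecompOfLength {n : ℕ} {k : Type*} [CommSemiring k]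
    (d r : ℕ) (F : MvPolynomial (Fin n) k) : Prop :=
  ∃ (g h : Fin r → MvPolynomial (Fin n) k) (a b : Fin r → ℕ),
    (∀ i, 1 ≤ a i ∧ a i ≤ d - 1 ∧ (g i).IsHomogeneous (a i)) ∧
    (∀ i, 1 ≤ b i ∧ b i ≤ d - 1 ∧ (h i).IsHomogeneous (b i)) ∧
    F = ∑ i, g i * h i

universe u

section Hyperbolic

variable {k : Type*} [Field k] {ι : Type*} [Fintype ι]

/-- The polar form of the hyperbolic quadratic form `∑ i, a i * b i` on pairs `(a, b)`. -/
def hyperbolicPolar (k ι : Type*) [Field k] [Fintype ι] :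
    LinearMap.BilinForm k ((ι → k) × (ι → k)) :=
  LinearMap.mk₂ k (fun p q => ∑ i, (p.1 i * q.2 i + q.1 i * p.2 i))
    (fun p p' q => by
      rw [← Finset.sum_add_distrib]
      exact Finset.sum_congr rfl fun i _ => by simp; ring)
    (fun c p q => by
      rw [smul_eq_mul, Finset.mul_sum]
      exact Finset.sum_congr rfl fun i _ => by simp; ring)
    (fun p q q' => by
      rw [← Finset.sum_add_distrib]
      exact Finset.sum_congr rfl fun i _ => by simp; ring)
    (fun c p q => by
      rw [smul_eq_mul, Finset.mul_sum]
      exact Finset.sum_congr rfl fun i _ => by simp; ring)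

theorem hyperbolicPolar_apply (p q : (ι → k) × (ι → k)) :
    hyperbolicPolar k ι p q = ∑ i, (p.1 i * q.2 i + q.1 i * p.2 i) := rfl

theorem hyperbolicPolar_eq_sub (p q : (ι → k) × (ι → k)) :
    hyperbolicPolar k ι p q = ∑ i, (p + q).1 i * (p + q).2 i
      - ∑ i, p.1 i * p.2 i - ∑ i, q.1 i * q.2 i := by
  rw [hyperbolicPolar_apply, ← Finset.sum_sub_distrib, ← Finset.sum_sub_distrib]
  exact Finset.sum_congr rfl fun i _ => by simp; ring

theorem ker_hyperbolicPolar : LinearMap.ker (hyperbolicPolar k ι) = ⊥ := by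
  classical
  refine LinearMap.ker_eq_bot'.2 fun p hp => ?_
  ext i
  · simpa [hyperbolicPolar_apply, Pi.single_apply] using
      LinearMap.congr_fun hp (0, Pi.single i 1)
  · simpa [hyperbolicPolar_apply, Pi.single_apply] using
      LinearMap.congr_fun hp (Pi.single i 1, 0)

/-- Totally isotropic subspaces of hyperbolic space have at most half the dimension. -/
theorem finrank_le_of_hyperbolicPolar_eq_zero (W : Submodule k ((ι → k) × (ι → k)))
    (hW : ∀ p ∈ W, ∀ q ∈ W, hyperbolicPolar k ι p q = 0) :
    Module.finrank k W ≤ Fintype.card ι := by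
  have h := LinearMap.BilinForm.finrank_add_finrank_orthogonal' (B := hyperbolicPolar k ι) W
  have hle : Module.finrank k W ≤ Module.finrank k ((hyperbolicPolar k ι).orthogonal W) :=
    Submodule.finrank_mono fun q hq p hp => hW p hp q hq
  rw [ker_hyperbolicPolar, inf_bot_eq, finrank_bot, Module.finrank_prod,
    Module.finrank_fintype_fun_eq_card] at h
  omega

/-- Fewer than `card ι` linear conditions leave a vector on which the hyperbolic quadratic form
does not vanish. -/
theorem exists_hyperbolic_ne_zero {τ : Type*} [Fintype τ]
    (φ : τ → (ι → k) × (ι → k) →ₗ[k] k) (h : Fintype.card τ < Fintype.card ι) :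
    ∃ w : (ι → k) × (ι → k), (∀ t, φ t w = 0) ∧ ∑ i, w.1 i * w.2 i ≠ 0 := by
  by_contra! hcon
  have hker : ∀ w ∈ LinearMap.ker (LinearMap.pi φ), ∑ i, w.1 i * w.2 i = 0 := fun w hw =>
    hcon w fun t => by simpa using congr_fun (LinearMap.mem_ker.1 hw) t
  have h1 := finrank_le_of_hyperbolicPolar_eq_zero (LinearMap.ker (LinearMap.pi φ))
    fun p hp q hq => by
      rw [hyperbolicPolar_eq_sub, hker _ (add_mem hp hq), hker p hp, hker q hq]
      simp
  have h2 := (LinearMap.pi φ).finrank_range_add_finrank_ker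
  have h3 := (LinearMap.range (LinearMap.pi φ)).finrank_le
  rw [Module.finrank_prod, Module.finrank_fintype_fun_eq_card] at h2
  rw [Module.finrank_fintype_fun_eq_card] at h3
  omega

/-- A family of mutually orthogonal isotropic vectors admitting a dual family has at most
`card ι` members. -/
theorem card_le_of_isotropic_of_dual {κ : Type*} [Fintype κ] [DecidableEq κ]
    (p z : κ → (ι → k) × (ι → k)) (c : κ → k) (hc : ∀ i, c i ≠ 0)
    (hz : ∀ i j, hyperbolicPolar k ι (z i) (z j) = 0)
    (hpz : ∀ i j, hyperbolicPolar k ι (p i) (z j) = if i = j then c i else 0) :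
    Fintype.card κ ≤ Fintype.card ι := by
  have hli : LinearIndependent k z := by
    refine Fintype.linearIndependent_iff.2 fun g hg i => ?_
    have := congr_arg (hyperbolicPolar k ι (p i)) hg
    simpa [hpz, hc i] using this
  rw [← finrank_span_eq_card hli]
  refine finrank_le_of_hyperbolicPolar_eq_zero _ fun a ha b hb => ?_
  induction ha using Submodule.span_induction with
  | zero => simp
  | add x y _ _ hx hy => simp [hx, hy]
  | smul r x _ hx => simp [hx]
  | mem x hx =>
    obtain ⟨i, rfl⟩ := hx
    induction hb using Submodule.span_induction with
    | zero => simp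
    | add x y _ _ hx hy => simp [hx, hy]
    | smul r x _ hx => simp [hx]
    | mem x hx =>
      obtain ⟨j, rfl⟩ := hx
      exact hz i j

end Hyperbolic

/-- A common zero space of linear forms on `σ → k` contains a family dual to some of the
coordinate functions, of size at least the expected dimension. -/
theorem exists_dual_family_in_ker {k τ : Type*} {σ : Type u} [Field k] [Fintype σ] [Fintype τ]
    (l : τ → (σ → k) →ₗ[k] k) :
    ∃ (κ : Type u) (_ : Fintype κ) (_ : DecidableEq κ) (a : κ → σ) (p : κ → σ → k),
      Function.Injective a ∧ Fintype.card σ ≤ Fintype.card κ + Fintype.card τ ∧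
      (∀ i t, l t (p i) = 0) ∧ ∀ i j, p i (a j) = if i = j then 1 else 0 := by
  classical
  let K := LinearMap.ker (LinearMap.pi l)
  let π : σ → Module.Dual k K := fun s => (LinearMap.proj s).comp K.subtype
  obtain ⟨κ, a, ha, hspan, hli⟩ := exists_linearIndependent' k π
  have : Fintype κ := Fintype.ofInjective a ha
  let ψ : K →ₗ[k] κ → k := LinearMap.pi (π ∘ a)
  have hinj : Function.Injective ψ := by
    refine (injective_iff_map_eq_zero ψ).2 fun w hw => ?_
    have hle : Submodule.span k (Set.range π) ≤ LinearMap.ker (Module.Dual.eval k K w) := by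
      rw [← hspan, Submodule.span_le]
      rintro _ ⟨i, rfl⟩
      exact congr_fun hw i
    ext s
    exact hle (Submodule.subset_span ⟨s, rfl⟩)
  have hle : Module.finrank k K ≤ Fintype.card κ := by
    simpa using LinearMap.finrank_le_finrank_of_injective hinj
  have hge : Fintype.card κ ≤ Module.finrank k K := by
    simpa [Subspace.dual_finrank_eq] using hli.fintype_card_le_finrank
  have hsurj : Function.Surjective ψ :=
    (LinearMap.injective_iff_surjective_of_finrank_eq_finrank
      (by simpa using le_antisymm hle hge)).1 hinj
  choose p hp using fun i => hsurj (Pi.single i 1)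
  refine ⟨κ, inferInstance, inferInstance, a, fun i => (p i : σ → k), ha, ?_, fun i t => ?_,
    fun i j => ?_⟩
  · have h2 := (LinearMap.pi l).finrank_range_add_finrank_ker
    have h3 := (LinearMap.range (LinearMap.pi l)).finrank_le
    rw [Module.finrank_fintype_fun_eq_card] at h2 h3
    change _ + Module.finrank k K = _ at h2
    omega
  · exact congr_fun (LinearMap.mem_ker.1 (p i).2) t
  · refine (congr_fun (hp i) j).trans ?_
    simp [Pi.single_apply, eq_comm]

section Quadratic

open MvPolynomial

variable {k : Type*} [Field k] {σ : Type*}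

/-- A linear form evaluates as a linear functional. -/
theorem MvPolynomial.IsHomogeneous.exists_linearMap_eval {l : MvPolynomial σ k}
    (hl : l.IsHomogeneous 1) : ∃ L : (σ → k) →ₗ[k] k, ∀ v, eval v l = L v := by
  have : l ∈ Submodule.span k (Set.range (X : σ → MvPolynomial σ k)) := by
    rw [← homogeneousSubmodule_one_eq_span_X]
    exact hl
  clear hl
  induction this using Submodule.span_induction with
  | mem x hx =>
    obtain ⟨i, rfl⟩ := hx
    exact ⟨LinearMap.proj i, fun v => by simp⟩
  | zero => exact ⟨0, fun v => by simp⟩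
  | add x y _ _ hx hy =>
    obtain ⟨L, hL⟩ := hx
    obtain ⟨M, hM⟩ := hy
    exact ⟨L + M, fun v => by simp [hL, hM]⟩
  | smul r x _ hx =>
    obtain ⟨L, hL⟩ := hx
    exact ⟨r • L, fun v => by simp [hL, smul_eval]⟩

/-- A quadratic form has a bilinear polarization. -/
theorem MvPolynomial.IsHomogeneous.exists_polar {g : MvPolynomial σ k}
    (hg : g.IsHomogeneous 2) : ∃ B : LinearMap.BilinForm k (σ → k),
      ∀ v w, eval (v + w) g = eval v g + eval w g + B v w := by
  classical
  rw [g.as_sum]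
  refine Finset.sum_induction _ (fun g : MvPolynomial σ k => ∃ B : LinearMap.BilinForm k (σ → k),
      ∀ v w, eval (v + w) g = eval v g + eval w g + B v w) ?_ ⟨0, by simp⟩ ?_
  · rintro g h ⟨A, hA⟩ ⟨B, hB⟩
    exact ⟨A + B, fun v w => by simp [hA, hB]; ring⟩
  · intro d hd
    have hdeg : d.degree = 2 := by
      by_contra h
      exact mem_support_iff.1 hd (hg.coeff_eq_zero h)
    obtain ⟨i, j, rfl⟩ : ∃ i j, d = Finsupp.single i 1 + Finsupp.single j 1 := by
      have hd0 : d ≠ 0 := by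
        rintro rfl
        simp at hdeg
      obtain ⟨i, hi⟩ := Finsupp.ne_iff.1 hd0
      have hle : Finsupp.single i 1 ≤ d :=
        Finsupp.single_le_iff.2 (Nat.one_le_iff_ne_zero.2 hi)
      have hsub := add_tsub_cancel_of_le hle
      have hone : (d - Finsupp.single i 1).degree = 1 := by
        have := congr_arg Finsupp.degree hsub
        rw [map_add, hdeg, Finsupp.degree_single] at this
        omega
      have hmem : d - Finsupp.single i 1 ∈ Set.range fun a : σ => Finsupp.single a 1 := by
        rw [Finsupp.range_single_one]
        exact hone
      obtain ⟨j, hj⟩ := hmem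
      exact ⟨i, j, by rw [← hsub, ← hj]⟩
    refine ⟨coeff (Finsupp.single i 1 + Finsupp.single j 1) g •
      (LinearMap.BilinForm.linMulLin (LinearMap.proj i) (LinearMap.proj j) +
        LinearMap.BilinForm.linMulLin (LinearMap.proj j) (LinearMap.proj i)), fun v w => ?_⟩
    simp [eval_monomial, Finsupp.prod_add_index', pow_add]
    ring

end Quadratic

/-- A function on `V` that vanishes wherever some linear form does. -/
def VanishesOnHyperplane (k : Type*) {V : Type*} [Field k] [AddCommGroup V] [Module k V]
    (t : V → k) : Prop :=
  ∃ l : V →ₗ[k] k, ∀ v, l v = 0 → t v = 0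

/-- A product of two functions on `V` having bilinear polarizations. -/
def IsProductOfQuadratics (k : Type*) {V : Type*} [Field k] [AddCommGroup V] [Module k V]
    (t : V → k) : Prop :=
  ∃ (g h : V → k) (A B : LinearMap.BilinForm k V), (∀ v, t v = g v * h v) ∧
    (∀ v w, g (v + w) = g v + g w + A v w) ∧ (∀ v w, h (v + w) = h v + h w + B v w)

/-- A function restricting to `c j ^ 2 * H w` on four blocks `c, w`, with `H` hyperbolic of large
rank, is not a sum of three functions each of which vanishes on a hyperplane or is a product of
quadratics. -/
theorem not_sum_three_of_blocks {k V ι : Type*} [Field k] [AddCommGroup V] [Module k V]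
    [Fintype ι] (hι : 43 ≤ Fintype.card ι) (F : V → k) (P : (Fin 4 → k) →ₗ[k] V)
    (Z : Fin 4 → (ι → k) × (ι → k) →ₗ[k] V)
    (hPZ : ∀ c j w, F (P c + Z j w) = c j ^ 2 * ∑ i, w.1 i * w.2 i)
    (hZZ : ∀ i j w w', F (Z i w + Z j w') = 0)
    (t : Fin 3 → V → k) (hF : ∀ v, F v = ∑ i, t i v)
    (ht : ∀ i, VanishesOnHyperplane k (t i) ∨ IsProductOfQuadratics k (t i)) : False := by
  classical
  let Q : Fin 3 → Prop := fun i => IsProductOfQuadratics k (t i)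
  have hQ : ∀ i : {i // Q i}, IsProductOfQuadratics k (t i) := fun i => i.2
  have hL : ∀ i : {i // ¬ Q i}, VanishesOnHyperplane k (t i) := fun i => (ht i).resolve_right i.2
  choose g h A B hgh hg hh using hQ
  choose l hl using hL
  have hP0 : ∀ c, F (P c) = 0 := fun c => by simpa using hPZ c 0 0
  have hZ0 : ∀ j w, F (Z j w) = 0 := fun j w => by simpa using hZZ j j w 0
  have hcard : Fintype.card {i // Q i} + Fintype.card {i // ¬ Q i} = 3 := by
    rw [Fintype.card_subtype_compl, Fintype.card_fin]
    have := Fintype.card_subtype_le Q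
    rw [Fintype.card_fin] at this
    omega
  let Φ : V → ({i // Q i} → k) × ({i // Q i} → k) := fun v => (fun i => g i v, fun i => h i v)
  have hFΦ : ∀ v, (∀ i, l i v = 0) → F v = ∑ i, (Φ v).1 i * (Φ v).2 i := fun v hv => by
    rw [hF, ← Fintype.sum_subtype_add_sum_subtype Q,
      Finset.sum_eq_zero (s := (Finset.univ : Finset {i // ¬ Q i})) fun i _ => hl i v (hv i),
      add_zero]
    exact Finset.sum_congr rfl fun i _ => hgh i v
  have hpolar : ∀ v w, (∀ i, l i v = 0) → (∀ i, l i w = 0) → Φ (v + w) = Φ v + Φ w →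
      hyperbolicPolar k {i // Q i} (Φ v) (Φ w) = F (v + w) - F v - F w := by
    intro v w hv hw hvw
    rw [hyperbolicPolar_eq_sub, ← hvw, hFΦ v hv, hFΦ w hw, hFΦ (v + w) fun i => by simp [hv, hw]]
  have step : ∀ (S : Finset V) (j : Fin 4), S.card ≤ 7 → ∃ w : (ι → k) × (ι → k),
      ∑ i, w.1 i * w.2 i ≠ 0 ∧ (∀ i, l i (Z j w) = 0) ∧
      ∀ s ∈ S, Φ (s + Z j w) = Φ s + Φ (Z j w) := by
    intro S j hS
    obtain ⟨w, hw, hne⟩ := exists_hyperbolic_ne_zero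
      (τ := {i // ¬ Q i} ⊕ ({i // Q i} × S) ⊕ ({i // Q i} × S))
      (Sum.elim (fun i => l i ∘ₗ Z j)
        (Sum.elim (fun x => A x.1 x.2 ∘ₗ Z j) (fun x => B x.1 x.2 ∘ₗ Z j)))
      (by
        simp only [Fintype.card_sum, Fintype.card_prod, Fintype.card_coe]
        have := Nat.mul_le_mul_left (Fintype.card {i // Q i}) hS
        omega)
    refine ⟨w, hne, fun i => hw (.inl i), fun s hs => ?_⟩
    ext i
    · simpa [Φ, hg] using hw (.inr (.inl (i, ⟨s, hs⟩)))
    · simpa [Φ, hh] using hw (.inr (.inr (i, ⟨s, hs⟩)))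
  obtain ⟨κ, _, _, a, p, ha, hκ, hlp, hpa⟩ := exists_dual_family_in_ker fun i => l i ∘ₗ P
  have hκ4 : Fintype.card κ ≤ 4 := by simpa using Fintype.card_le_of_injective a ha
  let S : Finset V := Finset.univ.image fun i => P (p i)
  have hS : S.card ≤ 4 := Finset.card_image_le.trans hκ4
  obtain ⟨w₀, hw₀, hl₀, hS₀⟩ := step S 0 (by omega)
  have hS1 := Finset.card_insert_le (Z 0 w₀) S
  obtain ⟨w₁, hw₁, hl₁, hS₁⟩ := step (insert (Z 0 w₀) S) 1 (by omega)
  have hS2 := Finset.card_insert_le (Z 1 w₁) (insert (Z 0 w₀) S)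
  obtain ⟨w₂, hw₂, hl₂, hS₂⟩ := step (insert (Z 1 w₁) (insert (Z 0 w₀) S)) 2 (by omega)
  have hS3 := Finset.card_insert_le (Z 2 w₂) (insert (Z 1 w₁) (insert (Z 0 w₀) S))
  obtain ⟨w₃, hw₃, hl₃, hS₃⟩ :=
    step (insert (Z 2 w₂) (insert (Z 1 w₁) (insert (Z 0 w₀) S))) 3 (by omega)
  simp only [Finset.forall_mem_insert] at hS₁ hS₂ hS₃
  obtain ⟨w, hw, hlw, hSw, hww⟩ : ∃ w : Fin 4 → (ι → k) × (ι → k),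
      (∀ j, ∑ i, (w j).1 i * (w j).2 i ≠ 0) ∧ (∀ j i, l i (Z j (w j)) = 0) ∧
      (∀ j, ∀ s ∈ S, Φ (s + Z j (w j)) = Φ s + Φ (Z j (w j))) ∧
      ∀ i j, i < j → Φ (Z i (w i) + Z j (w j)) = Φ (Z i (w i)) + Φ (Z j (w j)) := by
    refine ⟨![w₀, w₁, w₂, w₃], ?_, ?_, ?_, ?_⟩
    · simpa [Fin.forall_fin_succ] using ⟨hw₀, hw₁, hw₂, hw₃⟩
    · rw [Fin.forall_fin_succ, Fin.forall_fin_succ, Fin.forall_fin_succ, Fin.forall_fin_one]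
      exact ⟨hl₀, hl₁, hl₂, hl₃⟩
    · rw [Fin.forall_fin_succ, Fin.forall_fin_succ, Fin.forall_fin_succ, Fin.forall_fin_one]
      exact ⟨hS₀, hS₁.2, hS₂.2.2, hS₃.2.2.2⟩
    · intro i j hij
      fin_cases i <;> fin_cases j <;> first | exact absurd hij (by decide) | skip
      exacts [hS₁.1, hS₂.2.1, hS₃.2.2.1, hS₂.1, hS₃.2.1, hS₃.1]
  have hfin := card_le_of_isotropic_of_dual (fun i => Φ (P (p i)))
    (fun i => Φ (Z (a i) (w (a i)))) (fun i => ∑ j, (w (a i)).1 j * (w (a i)).2 j)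
    (fun i => hw (a i)) ?_ ?_
  · rw [Fintype.card_fin] at hκ
    omega
  · intro i j
    rcases lt_trichotomy (a i) (a j) with hij | hij | hij
    · rw [hpolar _ _ (hlw _) (hlw _) (hww _ _ hij), hZZ, hZ0, hZ0]
      simp
    · have h0 := hFΦ _ (hlw (a j))
      rw [hZ0] at h0
      rw [hij, hyperbolicPolar_apply, Finset.sum_add_distrib, ← h0, add_zero]
    · have hcomm := hww _ _ hij
      rw [add_comm (Z _ _), add_comm (Φ _)] at hcomm
      rw [hpolar _ _ (hlw _) (hlw _) hcomm, hZZ, hZ0, hZ0]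
      simp
  · intro i j
    rw [hpolar _ _ (hlp i) (hlw _)
      (hSw _ _ (Finset.mem_image_of_mem _ (Finset.mem_univ i))), hPZ, hP0, hZ0, hpa]
    split_ifs with hij
    · simp [hij]
    · simp

/-- Evaluating a strength decomposition of a quartic. -/
theorem HasStrengthDecompOfLength.eval_eq_sum {n r : ℕ} {k : Type*} [Field k]
    {F : MvPolynomial (Fin n) k} (hF : F.IsHomogeneous 4)
    (hdec : HasStrengthDecompOfLength 4 r F) :
    ∃ t : Fin r → (Fin n → k) → k, (∀ v, MvPolynomial.eval v F = ∑ i, t i v) ∧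
      ∀ i, VanishesOnHyperplane k (t i) ∨ IsProductOfQuadratics k (t i) := by
  obtain ⟨g, h, a, b, hg, hh, hsum⟩ := hdec
  have hF4 : F = ∑ i, if 4 = a i + b i then g i * h i else 0 := by
    rw [← show MvPolynomial.homogeneousComponent 4 F = F by
      rw [MvPolynomial.homogeneousComponent_of_mem hF, if_pos rfl]]
    nth_rw 1 [hsum]
    rw [map_sum]
    exact Finset.sum_congr rfl fun i _ =>
      MvPolynomial.homogeneousComponent_of_mem ((hg i).2.2.mul (hh i).2.2)
  refine ⟨fun i v => MvPolynomial.eval v (if 4 = a i + b i then g i * h i else 0), fun v => ?_,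
    fun i => ?_⟩
  · rw [hF4, map_sum]
  obtain ⟨ha1, ha3, hga⟩ := hg i
  obtain ⟨hb1, hb3, hhb⟩ := hh i
  by_cases hab : 4 = a i + b i
  · simp only [if_pos hab, map_mul]
    obtain ha | ha | hb : a i = 1 ∨ a i = 2 ∨ b i = 1 := by omega
    · rw [ha] at hga
      obtain ⟨L, hL⟩ := hga.exists_linearMap_eval
      exact .inl ⟨L, fun v hv => by simp [hL, hv]⟩
    · have hb : b i = 2 := by omega
      rw [ha] at hga
      rw [hb] at hhb
      obtain ⟨A, hA⟩ := hga.exists_polar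
      obtain ⟨B, hB⟩ := hhb.exists_polar
      exact .inr ⟨_, _, A, B, fun v => rfl, hA, hB⟩
    · rw [hb] at hhb
      obtain ⟨L, hL⟩ := hhb.exists_linearMap_eval
      exact .inl ⟨L, fun v hv => by simp [hL, hv]⟩
  · exact .inl ⟨0, fun v _ => by simp [hab]⟩

/-- Over an algebraically closed field `k`, there exist `n > 0`, homogeneous
polynomials `x, y, u, v` of degree 1 and `f, g, p, q` of degree 2 in `k[x_1,…,x_n]`
such that `x²f + y²g + u²p + v²q` has strength exactly 4. -/
theorem exists_quartic_of_strength_four (k : Type*) [Field k] [IsAlgClosed k] :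
    ∃ (n : ℕ), 0 < n ∧ ∃ x y u v f g p q : MvPolynomial (Fin n) k,
      x.IsHomogeneous 1 ∧ y.IsHomogeneous 1 ∧ u.IsHomogeneous 1 ∧ v.IsHomogeneous 1 ∧
      f.IsHomogeneous 2 ∧ g.IsHomogeneous 2 ∧ p.IsHomogeneous 2 ∧ q.IsHomogeneous 2 ∧
      HasStrengthDecompOfLength 4 4 (x ^ 2 * f + y ^ 2 * g + u ^ 2 * p + v ^ 2 * q) ∧
      ¬ HasStrengthDecompOfLength 4 3 (x ^ 2 * f + y ^ 2 * g + u ^ 2 * p + v ^ 2 * q) := by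
  obtain ⟨n, hn, ⟨e⟩⟩ : ∃ n, 0 < n ∧
      Nonempty ((Fin 4 ⊕ (Fin 4 × (Fin 43 ⊕ Fin 43))) ≃ Fin n) :=
    ⟨_, Fintype.card_pos, ⟨Fintype.equivFin _⟩⟩
  let x : Fin 4 → MvPolynomial (Fin n) k := fun j => .X (e (.inl j))
  let f : Fin 4 → MvPolynomial (Fin n) k := fun j =>
    ∑ i, .X (e (.inr (j, .inl i))) * .X (e (.inr (j, .inr i)))
  have hx : ∀ j, (x j).IsHomogeneous 1 := fun j => MvPolynomial.isHomogeneous_X k _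
  have hf : ∀ j, (f j).IsHomogeneous 2 := fun j => MvPolynomial.IsHomogeneous.sum _ _ _ fun i _ =>
    (MvPolynomial.isHomogeneous_X k _).mul (MvPolynomial.isHomogeneous_X k _)
  have hx2 : ∀ j, (x j ^ 2).IsHomogeneous 2 := fun j => (hx j).pow 2
  have hsum : x 0 ^ 2 * f 0 + x 1 ^ 2 * f 1 + x 2 ^ 2 * f 2 + x 3 ^ 2 * f 3 =
      ∑ j, x j ^ 2 * f j := (Fin.sum_univ_four fun j => x j ^ 2 * f j).symm
  refine ⟨n, hn, x 0, x 1, x 2, x 3, f 0, f 1, f 2, f 3, hx 0, hx 1, hx 2, hx 3,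
    hf 0, hf 1, hf 2, hf 3, ?_, ?_⟩
  · exact ⟨fun j => x j ^ 2, f, fun _ => 2, fun _ => 2, fun j => ⟨by simp, by simp, hx2 j⟩,
      fun j => ⟨by simp, by simp, hf j⟩, hsum⟩
  intro hdec
  rw [hsum] at hdec
  obtain ⟨t, ht, htype⟩ := hdec.eval_eq_sum
    (MvPolynomial.IsHomogeneous.sum _ _ _ fun j _ => (hx2 j).mul (hf j))
  let P : (Fin 4 → k) →ₗ[k] Fin n → k :=
    LinearMap.funLeft k k e.symm ∘ₗ
      { toFun := fun c => Sum.elim c 0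
        map_add' := fun c d => by ext (i | i) <;> simp
        map_smul' := fun r c => by ext (i | i) <;> simp }
  let Z : Fin 4 → (Fin 43 → k) × (Fin 43 → k) →ₗ[k] Fin n → k := fun j =>
    LinearMap.funLeft k k e.symm ∘ₗ
      { toFun := fun w => Sum.elim 0 fun y => if j = y.1 then Sum.elim w.1 w.2 y.2 else 0
        map_add' := fun w w' => by
          ext (i | ⟨i, i' | i'⟩)
          · simp
          all_goals by_cases hij : j = i <;> simp [hij]
        map_smul' := fun r w => by
          ext (i | ⟨i, i' | i'⟩)
          · simp
          all_goals by_cases hij : j = i <;> simp [hij] }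
  refine not_sum_three_of_blocks (by simp) _ P Z (fun c j w => ?_) (fun i j w w' => ?_) t ht htype
  · simp only [map_sum, map_mul, map_pow, MvPolynomial.eval_X, x, f]
    rw [Finset.sum_eq_single j]
    · simp [P, Z, LinearMap.funLeft_apply]
    · intro i _ hij
      simp [P, Z, LinearMap.funLeft_apply, hij.symm]
    · simp
  · simp [x, Z, LinearMap.funLeft_apply]
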